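/- arXiv:1903.04142 — 2 statements merged into one kernel-verified Lean document; each statement's English description precedes it below -/
import Mathlib

section
/- Let α ∈ (0,1), m = [1/α] + 1, s, j ∈ ℤ⁺ with s − j + 1 ∈ ℤ⁺ and s − 1 ≥ (2/α)j + 3j, and let γ ∈ ℤ⁺ with γ ≤ 2j + 2. There exists C > 0 such that for every T > 0, every λ > 0, and every sufficiently regular u : ℝ × [0,T] → ℝ satisfying ⟨x⟩^m |u(t,x)| ≥ λ/2 for all (t,x) ∈ [0,T] × ℝ, one has ‖ ⟨x⟩^m ∂_x^γ ( |u|^α ∂_x^{2j−1} u ) ‖_{L_T^1 L_x^2} ≤ C T λ^{α−1} ‖u‖_{X_T}^2 + C T λ^{α−γ} ‖u‖_{X_T}^{γ+1}. -/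
open MeasureTheory Filter Set
open scoped ENNReal NNReal

noncomputable section

/-- Japanese bracket `⟨x⟩ = (1+x²)^{1/2}`. -/
def jap (x : ℝ) : ℝ := Real.sqrt (1 + x ^ 2)

/-- `L²(ℝ)` norm, valued in `ℝ≥0∞`. -/
def eL2 (g : ℝ → ℝ) : ℝ≥0∞ := eLpNorm g 2 volume

/-- `L^∞(ℝ)` norm, valued in `ℝ≥0∞`. -/
def eLinf (g : ℝ → ℝ) : ℝ≥0∞ := eLpNorm g ⊤ volume

/-- Integer Sobolev `H^s(ℝ)` norm (sum of `L²` norms of derivatives up to order `s`). -/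
def eHs (s : ℕ) (g : ℝ → ℝ) : ℝ≥0∞ := ∑ k ∈ Finset.range (s + 1), eL2 (iteratedDeriv k g)

/-- `sup_{0 ≤ t ≤ T}` of a time-dependent norm. -/
def eLTinf (T : ℝ) (N : ℝ → ℝ≥0∞) : ℝ≥0∞ := ⨆ t : Set.Icc (0:ℝ) T, N t

/-- `L²` norm in time on `[0,T]` at a fixed spatial point `x`. -/
def eLT2x (T : ℝ) (F : ℝ → ℝ → ℝ) (x : ℝ) : ℝ≥0∞ :=
  (∫⁻ t in Set.Ioc (0:ℝ) T, (‖F t x‖₊ : ℝ≥0∞) ^ 2) ^ (1/2 : ℝ)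

/-- The mixed norm `‖F‖_{L_T^1 L_x^2}`. -/
def eLT1L2 (T : ℝ) (F : ℝ → ℝ → ℝ) : ℝ≥0∞ := ∫⁻ t in Set.Ioc (0:ℝ) T, eL2 (F t)

/-- The mixed norm `‖F‖_{L_x^q L_T^2}`. -/
def eLxqLT2 (q T : ℝ) (F : ℝ → ℝ → ℝ) : ℝ≥0∞ :=
  (∫⁻ x : ℝ, eLT2x T F x ^ q) ^ (1 / q)

/-- The mixed norm `‖F‖_{L_x^∞ L_T^2}`. -/
def eLxInfLT2 (T : ℝ) (F : ℝ → ℝ → ℝ) : ℝ≥0∞ := ⨆ x : ℝ, eLT2x T F x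

/-- The norm `‖u‖_{X_T}` of the resolution space:
`‖u‖_{L_T^∞ H^s} + ‖⟨x⟩^m u‖_{L_T^∞ L_x^∞} + Σ_{γ=1}^{2j+2} ‖⟨x⟩^m ∂_x^γ u‖_{L_T^∞ L_x^2}
 + Σ_{l=0}^{j-1} ‖∂_x^{s+j-l} u‖_{L_x^∞ L_T^2}`. -/
def XT (s j m : ℕ) (T : ℝ) (u : ℝ → ℝ → ℝ) : ℝ≥0∞ :=
  eLTinf T (fun t => eHs s (u t))
  + eLTinf T (fun t => eLinf (fun x => jap x ^ m * u t x))
  + ∑ γ ∈ Finset.Icc 1 (2 * j + 2),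
      eLTinf T (fun t => eL2 (fun x => jap x ^ m * iteratedDeriv γ (u t) x))
  + ∑ l ∈ Finset.range j,
      eLxInfLT2 T (fun t x => iteratedDeriv (s + j - l) (u t) x)

/-- The nonlinearity `|u|^α ∂_x^{2j-1} u`. -/
def nonlin (α : ℝ) (j : ℕ) (u : ℝ → ℝ → ℝ) : ℝ → ℝ → ℝ :=
  fun t x => |u t x| ^ α * iteratedDeriv (2 * j - 1) (u t) x

lemma le_mul_zero_add_mul_succ {c : ℝ} (hc : 0 ≤ c) (L n : ℕ) (hn : n < L) :
    ∀ ε > 0, ∃ K : ℝ, 0 ≤ K ∧ ∀ E : ℕ → ℝ, (∀ k, 0 ≤ E k) →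
      (∀ k, k + 1 < L → ∀ η > 0, E (k + 1) ≤ η * E (k + 2) + (c + 1 / η) * E k) →
      E n ≤ K * E 0 + ε * E (n + 1) := by
  induction n with
  | zero =>
    intro ε hε
    refine ⟨1, zero_le_one, fun E h0 _ => ?_⟩
    have := mul_nonneg hε.le (h0 1)
    simpa using this
  | succ n ih =>
    intro ε hε
    have hκ : 0 < c + 1 / (ε / 2) := by positivity
    set κ := c + 1 / (ε / 2) with hκd
    obtain ⟨K, hK, h⟩ := ih (by omega) (1 / (2 * κ)) (by positivity)
    refine ⟨2 * (κ * K), by positivity, fun E h0 hE => ?_⟩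
    have h1 := mul_le_mul_of_nonneg_left (h E h0 hE) hκ.le
    have h2 := hE n hn (ε / 2) (by positivity)
    have h3 : κ * (K * E 0 + 1 / (2 * κ) * E (n + 1)) = κ * K * E 0 + E (n + 1) / 2 := by
      field_simp
    rw [h3] at h1
    rw [← hκd] at h2
    show E (n + 1) ≤ 2 * (κ * K) * E 0 + ε * E (n + 2)
    linarith

/-- A discrete interpolation inequality: the interior terms are bounded by the two endpoints. -/
lemma exists_le_mul_endpoints {c : ℝ} (hc : 0 ≤ c) (L : ℕ) :
    ∃ K : ℝ, 0 ≤ K ∧ ∀ E : ℕ → ℝ, (∀ k, 0 ≤ E k) →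
      (∀ k, k + 1 < L → ∀ η > 0, E (k + 1) ≤ η * E (k + 2) + (c + 1 / η) * E k) →
      ∀ n ≤ L, E n ≤ K * (E 0 + E L) := by
  have H : ∀ n, ∃ K : ℝ, 0 ≤ K ∧ (n < L → ∀ E : ℕ → ℝ, (∀ k, 0 ≤ E k) →
      (∀ k, k + 1 < L → ∀ η > 0, E (k + 1) ≤ η * E (k + 2) + (c + 1 / η) * E k) →
      E n ≤ K * E 0 + E (n + 1)) := by
    intro n
    by_cases hn : n < L
    · obtain ⟨K, hK, h⟩ := le_mul_zero_add_mul_succ hc L n hn 1 one_pos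
      exact ⟨K, hK, fun _ E h0 hE => by simpa using h E h0 hE⟩
    · exact ⟨0, le_rfl, fun h => absurd h hn⟩
  choose K hK h using H
  have hS : 0 ≤ ∑ i ∈ Finset.range L, K i := Finset.sum_nonneg fun i _ => hK i
  refine ⟨1 + ∑ i ∈ Finset.range L, K i, by positivity, fun E h0 hE n hn => ?_⟩
  have key : E n ≤ (∑ i ∈ Finset.Ico n L, K i) * E 0 + E L := by
    induction hn using Nat.decreasingInduction with
    | self => simp
    | of_succ k hk ih =>
      have := h k hk E h0 hE
      rw [Finset.sum_eq_sum_Ico_succ_bot hk]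
      linarith
  have h1 : ∑ i ∈ Finset.Ico n L, K i ≤ ∑ i ∈ Finset.range L, K i := by
    apply Finset.sum_le_sum_of_subset_of_nonneg
    · intro i hi
      simp only [Finset.mem_Ico, Finset.mem_range] at *
      exact hi.2
    · exact fun i _ _ => hK i
  have h2 := mul_le_mul_of_nonneg_right h1 (h0 0)
  have h3 := mul_nonneg hS (h0 L)
  have h4 := h0 0
  nlinarith

/-- Weighted interpolation between consecutive derivatives, with a bounded weight `exp g`. -/
lemma integral_exp_mul_sq_le {g g' h h₁ h₂ : ℝ → ℝ} {B w w₀ w₂ η : ℝ}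
    (hg : ∀ x, HasDerivAt g (g' x) x) (hg'c : Continuous g') (hg' : ∀ x, |g' x| ≤ 1)
    (hg0 : ∀ x, 0 ≤ g x) (hgB : ∀ x, g x ≤ B)
    (hh : ∀ x, HasDerivAt h (h₁ x) x) (hh₁ : ∀ x, HasDerivAt h₁ (h₂ x) x) (hh₂ : Continuous h₂)
    (ih : Integrable fun x => h x ^ 2) (ih₁ : Integrable fun x => h₁ x ^ 2)
    (ih₂ : Integrable fun x => h₂ x ^ 2) (hw : w₀ + w₂ = 2 * w) (hw₀ : w ≤ w₀) (hη : 0 < η) :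
    ∫ x, Real.exp (2 * w * g x) * h₁ x ^ 2 ≤ η * (∫ x, Real.exp (2 * w₂ * g x) * h₂ x ^ 2)
      + (4 * w ^ 2 + 1 / η) * ∫ x, Real.exp (2 * w₀ * g x) * h x ^ 2 := by
  have cg : Continuous g := continuous_iff_continuousAt.2 fun x => (hg x).continuousAt
  have ch : Continuous h := continuous_iff_continuousAt.2 fun x => (hh x).continuousAt
  have ch₁ : Continuous h₁ := continuous_iff_continuousAt.2 fun x => (hh₁ x).continuousAt
  have bdd : ∀ (v : ℝ) (p : ℝ → ℝ), Integrable p →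
      Integrable fun x => Real.exp (2 * v * g x) * p x := by
    intro v p hp
    refine hp.bdd_mul (c := Real.exp (|2 * v| * B)) (by fun_prop) (ae_of_all _ fun x => ?_)
    rw [Real.norm_eq_abs, Real.abs_exp, Real.exp_le_exp]
    calc 2 * v * g x ≤ |2 * v| * g x := mul_le_mul_of_nonneg_right (le_abs_self _) (hg0 x)
      _ ≤ _ := mul_le_mul_of_nonneg_left (hgB x) (abs_nonneg _)
  have prod : ∀ p q : ℝ → ℝ, Continuous p → Continuous q → Integrable (fun x => p x ^ 2) →
      Integrable (fun x => q x ^ 2) → Integrable fun x => p x * q x := by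
    intro p q cp cq hp hq
    refine (hp.add hq).mono' (by fun_prop) (ae_of_all _ fun x => ?_)
    rw [Real.norm_eq_abs, abs_le]
    simp only [Pi.add_apply]
    constructor <;> nlinarith [sq_nonneg (p x + q x), sq_nonneg (p x - q x)]
  have i01 := bdd w _ (prod h h₁ ch ch₁ ih ih₁)
  have i02 := bdd w _ (prod h h₂ ch hh₂ ih ih₂)
  have i11 := bdd w _ ih₁
  have i01' : Integrable fun x => g' x * (Real.exp (2 * w * g x) * (h x * h₁ x)) :=
    i01.bdd_mul (c := 1) (by fun_prop) (ae_of_all _ fun x => by simpa using hg' x)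
  have iD : Integrable fun x => 2 * w * (g' x * (Real.exp (2 * w * g x) * (h x * h₁ x)))
      + (Real.exp (2 * w * g x) * h₁ x ^ 2 + Real.exp (2 * w * g x) * (h x * h₂ x)) :=
    (i01'.const_mul _).add (i11.add i02)
  have hD : ∀ x, HasDerivAt (fun x => Real.exp (2 * w * g x) * (h x * h₁ x))
      (2 * w * (g' x * (Real.exp (2 * w * g x) * (h x * h₁ x)))
      + (Real.exp (2 * w * g x) * h₁ x ^ 2 + Real.exp (2 * w * g x) * (h x * h₂ x))) x := by
    intro x
    refine ((((hg x).const_mul (2 * w)).exp).mul ((hh x).mul (hh₁ x))).congr_deriv ?_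
    simp only [Pi.mul_apply]
    ring
  have zero := integral_eq_zero_of_hasDerivAt_of_integrable hD iD i01
  have i00 := bdd w₀ _ ih
  have i22 := bdd w₂ _ ih₂
  have pt : ∀ x, Real.exp (2 * w * g x) * h₁ x ^ 2
      ≤ 2 * (2 * w * (g' x * (Real.exp (2 * w * g x) * (h x * h₁ x)))
      + (Real.exp (2 * w * g x) * h₁ x ^ 2 + Real.exp (2 * w * g x) * (h x * h₂ x)))
      + (η * (Real.exp (2 * w₂ * g x) * h₂ x ^ 2)
      + (4 * w ^ 2 + 1 / η) * (Real.exp (2 * w₀ * g x) * h x ^ 2)) := by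
    intro x
    have e1 : Real.exp (2 * w * g x) = Real.exp (w₀ * g x) * Real.exp (w₂ * g x) := by
      rw [← Real.exp_add, ← hw]; ring_nf
    have e2 : ∀ v, Real.exp (2 * v * g x) = Real.exp (v * g x) ^ 2 := by
      intro v; rw [sq, ← Real.exp_add]; ring_nf
    have e3 : Real.exp (2 * w * g x) ≤ Real.exp (2 * w₀ * g x) :=
      Real.exp_le_exp.2 (by nlinarith [hg0 x])
    have t1 : -(Real.exp (2 * w * g x) * (h x * h₂ x)) * 2
        ≤ η * (Real.exp (2 * w₂ * g x) * h₂ x ^ 2)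
          + 1 / η * (Real.exp (2 * w₀ * g x) * h x ^ 2) := by
      rw [e1, e2, e2]
      have : 0 ≤ 1 / η * (η * (Real.exp (w₂ * g x) * h₂ x) + Real.exp (w₀ * g x) * h x) ^ 2 := by
        positivity
      have h' : 1 / η * (η * (Real.exp (w₂ * g x) * h₂ x) + Real.exp (w₀ * g x) * h x) ^ 2
          = η * (Real.exp (w₂ * g x) * h₂ x) ^ 2
            + 2 * (Real.exp (w₂ * g x) * h₂ x) * (Real.exp (w₀ * g x) * h x)
            + 1 / η * (Real.exp (w₀ * g x) * h x) ^ 2 := by field_simp; ring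
      nlinarith
    have t2 : -(2 * w * (g' x * (h x * h₁ x))) * 2 ≤ h₁ x ^ 2 + 4 * w ^ 2 * h x ^ 2 := by
      have hs : g' x ^ 2 ≤ 1 := by rw [← sq_abs]; exact pow_le_one₀ (abs_nonneg _) (hg' x)
      have := mul_le_mul_of_nonneg_left hs (by positivity : 0 ≤ 4 * w ^ 2 * h x ^ 2)
      nlinarith [sq_nonneg (h₁ x + 2 * w * g' x * h x)]
    have t3 := mul_le_mul_of_nonneg_left t2 (Real.exp_pos (2 * w * g x)).le
    have t4 := mul_le_mul_of_nonneg_left e3 (by positivity : 0 ≤ 4 * w ^ 2 * h x ^ 2)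
    nlinarith
  have iR : Integrable fun x => η * (Real.exp (2 * w₂ * g x) * h₂ x ^ 2)
      + (4 * w ^ 2 + 1 / η) * (Real.exp (2 * w₀ * g x) * h x ^ 2) :=
    (i22.const_mul η).add (i00.const_mul (4 * w ^ 2 + 1 / η))
  refine (integral_mono i11 ((iD.const_mul 2).add iR) pt).trans (le_of_eq ?_)
  simp only [Pi.add_apply]
  rw [integral_add (iD.const_mul 2) iR, integral_const_mul, zero]
  rw [integral_add (i22.const_mul η) (i00.const_mul _), integral_const_mul, integral_const_mul]
  ring

lemma one_le_jap (x : ℝ) : 1 ≤ jap x := by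
  rw [jap, Real.one_le_sqrt]
  nlinarith [sq_nonneg x]

lemma jap_pos (x : ℝ) : 0 < jap x := one_pos.trans_le (one_le_jap x)

lemma jap_sq (x : ℝ) : jap x ^ 2 = 1 + x ^ 2 := Real.sq_sqrt (by positivity)

@[fun_prop]
lemma continuous_jap : Continuous jap := by
  unfold jap
  fun_prop

lemma log_jap (x : ℝ) : Real.log (jap x) = Real.log (1 + x ^ 2) / 2 := by
  rw [← jap_sq, Real.log_pow]
  push_cast
  ring

lemma hasDerivAt_jap (x : ℝ) : HasDerivAt jap (x / jap x) x := by
  have h : HasDerivAt (fun x : ℝ => 1 + x ^ 2) (2 * x) x := by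
    simpa using (hasDerivAt_pow 2 x).const_add 1
  have := h.sqrt (by positivity)
  refine this.congr_deriv ?_
  have := (jap_pos x).ne'
  change 2 * x / (2 * jap x) = _
  field_simp

lemma abs_le_jap (x : ℝ) : |x| ≤ jap x := by
  refine abs_le_of_sq_le_sq ?_ (jap_pos x).le
  rw [jap_sq]
  linarith

lemma lintegral_sq_eq (g : ℝ → ℝ) : ∫⁻ x, ENNReal.ofReal (g x ^ 2) = eL2 g ^ 2 := by
  have := eLpNorm_nnreal_pow_eq_lintegral (f := g) (μ := volume) (p := 2) two_ne_zero
  simp only [NNReal.coe_ofNat, ENNReal.coe_ofNat, ENNReal.rpow_ofNat] at this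
  rw [eL2, this]
  refine lintegral_congr fun x => ?_
  rw [← sq_abs, ENNReal.ofReal_pow (abs_nonneg _), ← Real.enorm_eq_ofReal_abs]

lemma eL2_le_ofReal_iff {g : ℝ → ℝ} {N : ℝ} (hN : 0 ≤ N) :
    eL2 g ≤ ENNReal.ofReal N ↔ ∫⁻ x, ENNReal.ofReal (g x ^ 2) ≤ ENNReal.ofReal (N ^ 2) := by
  rw [lintegral_sq_eq, ENNReal.ofReal_pow hN, ENNReal.pow_le_pow_left_iff two_ne_zero]

lemma integrable_sq_of_eL2_le {g : ℝ → ℝ} (hg : Continuous g) {N : ℝ} (hN : 0 ≤ N)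
    (h : eL2 g ≤ ENNReal.ofReal N) :
    Integrable (fun x => g x ^ 2) ∧ ∫ x, g x ^ 2 ≤ N ^ 2 := by
  rw [eL2_le_ofReal_iff hN] at h
  have hi : Integrable fun x => g x ^ 2 := by
    refine ⟨by fun_prop, ?_⟩
    rw [hasFiniteIntegral_iff_ofReal (ae_of_all _ fun x => sq_nonneg _)]
    exact h.trans_lt ENNReal.ofReal_lt_top
  refine ⟨hi, ?_⟩
  rw [← ofReal_integral_eq_lintegral_ofReal hi (ae_of_all _ fun x => sq_nonneg _)] at h
  exact (ENNReal.ofReal_le_ofReal_iff (by positivity)).1 h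

lemma sq_le_integral_add_integral {h h₁ : ℝ → ℝ} (hh : ∀ x, HasDerivAt h (h₁ x) x)
    (hc : Continuous h₁) (ih : Integrable fun x => h x ^ 2)
    (ih₁ : Integrable fun x => h₁ x ^ 2) (x : ℝ) :
    h x ^ 2 ≤ (∫ y, h y ^ 2) + ∫ y, h₁ y ^ 2 := by
  have ch : Continuous h := continuous_iff_continuousAt.2 fun x => (hh x).continuousAt
  have hd : ∀ y, HasDerivAt (fun y => h y ^ 2) (2 * h y * h₁ y) y := fun y =>
    ((hh y).fun_pow 2).congr_deriv (by simp)
  have pt : ∀ y, |2 * h y * h₁ y| ≤ h y ^ 2 + h₁ y ^ 2 := fun y => by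
    rw [abs_le]
    constructor <;> nlinarith [sq_nonneg (h y + h₁ y), sq_nonneg (h y - h₁ y)]
  have is : Integrable fun y => h y ^ 2 + h₁ y ^ 2 := ih.add ih₁
  have iD : Integrable fun y => 2 * h y * h₁ y :=
    is.mono' (by fun_prop) (ae_of_all _ pt)
  have lim := tendsto_zero_of_hasDerivAt_of_integrableOn_Iic (a := x) (fun y _ => hd y)
    iD.integrableOn ih.integrableOn
  have := integral_Iic_of_hasDerivAt_of_tendsto' (a := x) (fun y _ => hd y) iD.integrableOn lim
  rw [sub_zero] at this
  rw [← this, ← integral_add ih ih₁]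
  calc ∫ y in Set.Iic x, 2 * h y * h₁ y ≤ ∫ y in Set.Iic x, (h y ^ 2 + h₁ y ^ 2) :=
        integral_mono iD.integrableOn is.integrableOn fun y => (le_abs_self _).trans (pt y)
    _ ≤ _ := setIntegral_le_integral is (ae_of_all _ fun y => by
        simp only [Pi.zero_apply]; positivity)

lemma ContDiff.hasDerivAt_iteratedDeriv {f : ℝ → ℝ} (hf : ContDiff ℝ (⊤ : ℕ∞) f) (k : ℕ)
    (x : ℝ) : HasDerivAt (iteratedDeriv k f) (iteratedDeriv (k + 1) f x) x := by
  rw [iteratedDeriv_succ]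
  exact (hf.differentiable_iteratedDeriv k (by exact_mod_cast ENat.natCast_lt_top k) x).hasDerivAt

lemma ContDiff.continuous_iteratedDeriv_of_top {f : ℝ → ℝ} (hf : ContDiff ℝ (⊤ : ℕ∞) f) (k : ℕ) :
    Continuous (iteratedDeriv k f) :=
  hf.continuous_iteratedDeriv k (by exact_mod_cast le_top)

/-- The logarithm of the truncated bracket `⟨x⟩ / ⟨εx⟩`. -/
def logJap (ε x : ℝ) : ℝ := (Real.log (1 + x ^ 2) - Real.log (1 + (ε * x) ^ 2)) / 2

lemma logJap_le_log_jap (ε x : ℝ) : logJap ε x ≤ Real.log (jap x) := by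
  rw [log_jap, logJap]
  have := Real.log_nonneg (by nlinarith [sq_nonneg (ε * x)] : 1 ≤ 1 + (ε * x) ^ 2)
  linarith

lemma logJap_nonneg {ε : ℝ} (h0 : 0 < ε) (h1 : ε ≤ 1) (x : ℝ) : 0 ≤ logJap ε x := by
  have : Real.log (1 + (ε * x) ^ 2) ≤ Real.log (1 + x ^ 2) := by
    apply Real.log_le_log (by positivity)
    rw [mul_pow]
    nlinarith [mul_le_mul_of_nonneg_right (pow_le_one₀ h0.le h1 : ε ^ 2 ≤ 1) (sq_nonneg x)]
  unfold logJap
  linarith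

lemma logJap_le {ε : ℝ} (h0 : 0 < ε) (h1 : ε ≤ 1) (x : ℝ) : logJap ε x ≤ Real.log (ε⁻¹ ^ 2) / 2 := by
  have : Real.log (1 + x ^ 2) ≤ Real.log (ε⁻¹ ^ 2 * (1 + (ε * x) ^ 2)) := by
    apply Real.log_le_log (by positivity)
    have : ε⁻¹ ^ 2 * (1 + (ε * x) ^ 2) = ε⁻¹ ^ 2 + x ^ 2 := by field_simp
    rw [this]
    have : 1 ≤ ε⁻¹ ^ 2 := one_le_pow₀ ((one_le_inv₀ h0).2 h1)
    linarith
  rw [Real.log_mul (by positivity) (by positivity)] at this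
  unfold logJap
  linarith

lemma hasDerivAt_logJap (ε x : ℝ) :
    HasDerivAt (logJap ε) (x / (1 + x ^ 2) - ε * (ε * x) / (1 + (ε * x) ^ 2)) x := by
  have h : ∀ y : ℝ, HasDerivAt (fun x : ℝ => Real.log (1 + x ^ 2)) (2 * y / (1 + y ^ 2)) y := by
    intro y
    have : HasDerivAt (fun x : ℝ => 1 + x ^ 2) (2 * y) y := by
      simpa using (hasDerivAt_pow 2 y).const_add 1
    exact this.log (by positivity)
  have h2 := (h (ε * x)).comp x ((hasDerivAt_id x).const_mul ε)
  refine (((h x).sub h2).div_const 2).congr_deriv ?_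
  simp only [mul_one]
  ring

lemma abs_deriv_logJap_le {ε : ℝ} (h0 : 0 < ε) (h1 : ε ≤ 1) (x : ℝ) :
    |x / (1 + x ^ 2) - ε * (ε * x) / (1 + (ε * x) ^ 2)| ≤ 1 := by
  have h : ∀ y : ℝ, |y / (1 + y ^ 2)| ≤ 1 / 2 := by
    intro y
    rw [abs_div, abs_of_pos (by positivity : 0 < 1 + y ^ 2), div_le_iff₀ (by positivity),
      ← sq_abs y]
    nlinarith [sq_nonneg (|y| - 1)]
  calc _ ≤ |x / (1 + x ^ 2)| + |ε * (ε * x) / (1 + (ε * x) ^ 2)| := abs_sub _ _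
    _ = |x / (1 + x ^ 2)| + ε * |(ε * x) / (1 + (ε * x) ^ 2)| := by
        rw [mul_div_assoc, abs_mul, abs_of_pos h0]
    _ ≤ 1 / 2 + 1 * (1 / 2) := by gcongr <;> exact h _
    _ = 1 := by norm_num

/-- Interpolation between `⟨x⟩ ^ m ∂ ^ a f` and `∂ ^ (a + L) f` in `L²`. -/
lemma exists_weighted_interpolation (m a L : ℕ) (hL : 0 < L) :
    ∃ K : ℝ, 0 ≤ K ∧ ∀ f : ℝ → ℝ, ContDiff ℝ (⊤ : ℕ∞) f → ∀ N : ℝ, 0 ≤ N →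
      (∀ k ≤ L, eL2 (iteratedDeriv (a + k) f) ≤ ENNReal.ofReal N) →
      eL2 (fun x => jap x ^ m * iteratedDeriv a f x) ≤ ENNReal.ofReal N →
      ∀ n ≤ L, eL2 (fun x => jap x ^ ((m : ℝ) * ((L : ℝ) - n) / L) * iteratedDeriv (a + n) f x)
        ≤ ENNReal.ofReal (K * N) := by
  obtain ⟨K, hK, hE⟩ := exists_le_mul_endpoints (c := 4 * (m : ℝ) ^ 2) (by positivity) L
  refine ⟨Real.sqrt (2 * K), by positivity, fun f hf N hN hk ha n hn => ?_⟩
  set w : ℕ → ℝ := fun n => (m : ℝ) * ((L : ℝ) - n) / L with hw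
  have hL' : (0 : ℝ) < L := by exact_mod_cast hL
  have cont := hf.continuous_iteratedDeriv_of_top
  have int := fun k (h : k ≤ L) => integrable_sq_of_eL2_le (cont (a + k)) hN (hk k h)
  have inta := integrable_sq_of_eL2_le (by have := cont a; fun_prop) hN ha
  have w0 : w 0 = m := by simp only [hw]; field_simp; simp
  have wL : w L = 0 := by simp [hw]
  have reg : ∀ ε : ℝ, 0 < ε → ε ≤ 1 →
      ∫⁻ x, ENNReal.ofReal (Real.exp (2 * w n * logJap ε x) * iteratedDeriv (a + n) f x ^ 2)
        ≤ ENNReal.ofReal (2 * K * N ^ 2) := by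
    intro ε h0 h1
    have cg : Continuous (logJap ε) :=
      continuous_iff_continuousAt.2 fun x => (hasDerivAt_logJap ε x).continuousAt
    have h := hE (fun n => ∫ x, Real.exp (2 * w n * logJap ε x) * iteratedDeriv (a + n) f x ^ 2)
      (fun k => integral_nonneg fun x => by positivity) ?_ n hn
    · have e0 : ∫ x, Real.exp (2 * w 0 * logJap ε x) * iteratedDeriv (a + 0) f x ^ 2 ≤ N ^ 2 := by
        refine le_trans (integral_mono_of_nonneg (ae_of_all _ fun x => by positivity) inta.1
          (ae_of_all _ fun x => ?_)) inta.2
        simp only [add_zero, w0]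
        rw [mul_pow]
        gcongr
        rw [← Real.exp_log (jap_pos x), ← Real.exp_nat_mul, ← Real.exp_nat_mul, Real.exp_le_exp]
        have := mul_le_mul_of_nonneg_left (logJap_le_log_jap ε x) (Nat.cast_nonneg (α := ℝ) m)
        push_cast
        linarith
      have eL : ∫ x, Real.exp (2 * w L * logJap ε x) * iteratedDeriv (a + L) f x ^ 2 ≤ N ^ 2 := by
        simpa [wL] using (int L le_rfl).2
      rw [← ofReal_integral_eq_lintegral_ofReal _ (ae_of_all _ fun x => by positivity)]
      · apply ENNReal.ofReal_le_ofReal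
        have := mul_le_mul_of_nonneg_left (add_le_add e0 eL) hK
        linarith
      · refine (int n hn).1.bdd_mul (c := Real.exp (|2 * w n| * (Real.log (ε⁻¹ ^ 2) / 2)))
          (by fun_prop) (ae_of_all _ fun x => ?_)
        rw [Real.norm_eq_abs, Real.abs_exp, Real.exp_le_exp]
        calc 2 * w n * logJap ε x ≤ |2 * w n| * logJap ε x :=
              mul_le_mul_of_nonneg_right (le_abs_self _) (logJap_nonneg h0 h1 x)
          _ ≤ _ := mul_le_mul_of_nonneg_left (logJap_le h0 h1 x) (abs_nonneg _)
    · intro k hkL η hη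
      have hkL' : (k : ℝ) + 1 ≤ L := by exact_mod_cast hkL.le
      have hwk : w (k + 1) ≤ m := by
        simp only [hw]
        rw [div_le_iff₀ hL']
        push_cast
        have : (0 : ℝ) ≤ k := Nat.cast_nonneg k
        gcongr
        linarith
      have hwk0 : 0 ≤ w (k + 1) := by
        simp only [hw]
        push_cast
        have : 0 ≤ (L : ℝ) - (k + 1) := by linarith
        positivity
      refine (integral_exp_mul_sq_le (w₀ := w k) (w₂ := w (k + 2)) (hasDerivAt_logJap ε)
        ?_ (abs_deriv_logJap_le h0 h1) (logJap_nonneg h0 h1) (logJap_le h0 h1)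
        (hf.hasDerivAt_iteratedDeriv (a + k)) (hf.hasDerivAt_iteratedDeriv (a + (k + 1)))
        (cont _) (int k (by omega)).1 (int (k + 1) hkL.le).1 (int (k + 2) hkL).1 ?_ ?_ hη).trans ?_
      · refine Continuous.sub (Continuous.div (by fun_prop) (by fun_prop) fun x => by positivity)
          (Continuous.div (by fun_prop) (by fun_prop) fun x => by positivity)
      · simp only [hw]
        push_cast
        field_simp
        ring
      · simp only [hw]
        push_cast
        gcongr
        linarith
      · refine add_le_add le_rfl (mul_le_mul_of_nonneg_right ?_
          (integral_nonneg fun x => by positivity))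
        have := pow_le_pow_left₀ hwk0 hwk 2
        linarith
  rw [eL2_le_ofReal_iff (by positivity), mul_pow, Real.sq_sqrt (by positivity)]
  have lim : ∀ x, Tendsto (fun k : ℕ => ENNReal.ofReal
      (Real.exp (2 * w n * logJap (1 / ((k : ℝ) + 1)) x) * iteratedDeriv (a + n) f x ^ 2)) atTop
      (nhds (ENNReal.ofReal ((jap x ^ w n * iteratedDeriv (a + n) f x) ^ 2))) := by
    intro x
    have hc : Continuous fun ε => ENNReal.ofReal
        (Real.exp (2 * w n * logJap ε x) * iteratedDeriv (a + n) f x ^ 2) := by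
      unfold logJap
      refine ENNReal.continuous_ofReal.comp (Continuous.mul (Real.continuous_exp.comp
        (continuous_const.mul ((continuous_const.sub (Continuous.log (by fun_prop)
          fun ε => by positivity)).div_const 2))) continuous_const)
    have := (hc.tendsto 0).comp tendsto_one_div_add_atTop_nhds_zero_nat
    refine this.trans (le_of_eq ?_)
    congr 2
    rw [mul_pow, Real.rpow_def_of_pos (jap_pos x), ← Real.exp_nat_mul, log_jap]
    simp only [logJap]
    congr 2
    simp
    ring
  calc ∫⁻ x, ENNReal.ofReal ((jap x ^ w n * iteratedDeriv (a + n) f x) ^ 2)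
      = ∫⁻ x, liminf (fun k : ℕ => ENNReal.ofReal (Real.exp (2 * w n *
          logJap (1 / ((k : ℝ) + 1)) x) * iteratedDeriv (a + n) f x ^ 2)) atTop :=
        lintegral_congr fun x => (lim x).liminf_eq.symm
    _ ≤ liminf (fun k : ℕ => ∫⁻ x, ENNReal.ofReal (Real.exp (2 * w n *
          logJap (1 / ((k : ℝ) + 1)) x) * iteratedDeriv (a + n) f x ^ 2)) atTop := by
        refine lintegral_liminf_le fun k => ?_
        have cg : Continuous (logJap (1 / ((k : ℝ) + 1))) :=
          continuous_iff_continuousAt.2 fun x => (hasDerivAt_logJap _ x).continuousAt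
        have := cont (a + n)
        fun_prop
    _ ≤ liminf (fun _ : ℕ => ENNReal.ofReal (2 * K * N ^ 2)) atTop := by
        refine liminf_le_liminf (Eventually.of_forall fun k => reg _ (by positivity) ?_)
        rw [div_le_one (by positivity)]
        linarith [Nat.cast_nonneg (α := ℝ) k]
    _ = _ := liminf_const _

/-- Pointwise bounds for the derivatives of a power `φ` of `f`, read off from
`f φ' = α φ f'`. -/
lemma exists_abs_iteratedDeriv_le (α : ℝ) (k : ℕ) :
    ∃ C : ℝ, 0 ≤ C ∧ ∀ φ f : ℝ → ℝ, ContDiff ℝ (⊤ : ℕ∞) φ → ContDiff ℝ (⊤ : ℕ∞) f →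
      (∀ x, f x * deriv φ x = α * (φ x * deriv f x)) → ∀ x μ G A : ℝ, f x ≠ 0 → 1 ≤ μ → 0 ≤ G →
      |φ x| = A * |f x| → ∀ l ≤ k, (∀ i < l, |iteratedDeriv i f x| ≤ μ * |f x|) →
      (∀ i < l, A * |iteratedDeriv i f x| ≤ G) →
      |iteratedDeriv l φ x| ≤ C * (μ ^ (l - 1) * G + A * |iteratedDeriv l f x|) := by
  induction k with
  | zero =>
    refine ⟨1, zero_le_one, fun φ f _ _ _ x μ G A _ _ hG hA l hl _ _ => ?_⟩
    obtain rfl : l = 0 := by omega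
    simp only [iteratedDeriv_zero, hA, zero_le, Nat.sub_eq_zero_of_le, pow_zero, one_mul]
    linarith
  | succ k ih =>
    obtain ⟨C, hC, h⟩ := ih
    set S : ℝ := ∑ i ∈ Finset.range k, ((k.choose (i + 1) : ℕ) : ℝ) * (2 * C) with hS
    have hS0 : 0 ≤ S := Finset.sum_nonneg fun i _ => by positivity
    refine ⟨C + |α| + (|α| * S + S), by positivity,
      fun φ f hφ hf heq x μ G A hx hμ hG hA l hl hd hAd => ?_⟩
    have fpos : 0 < |f x| := abs_pos.2 hx
    have hA0 : 0 ≤ A := by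
      by_contra hneg
      have := mul_neg_of_neg_of_pos (not_le.1 hneg) fpos
      linarith [abs_nonneg (φ x)]
    have hX : ∀ l, 0 ≤ μ ^ (l - 1) * G + A * |iteratedDeriv l f x| := fun l => by positivity
    rcases Nat.lt_or_ge l (k + 1) with hlt | hge
    · refine (h φ f hφ hf heq x μ G A hx hμ hG hA l (by omega) hd hAd).trans ?_
      refine mul_le_mul_of_nonneg_right ?_ (hX l)
      have : 0 ≤ |α| + (|α| * S + S) := by positivity
      linarith
    obtain rfl : l = k + 1 := by omega
    clear hl hge
    have low : ∀ l i, 1 ≤ l → l ≤ k → i ≤ k →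
        |iteratedDeriv l φ x| * |iteratedDeriv i f x| ≤ 2 * C * (μ ^ k * G) * |f x| := by
      intro l i hl1 hlk hik
      have h1 := h φ f hφ hf heq x μ G A hx hμ hG hA l hlk
        (fun i hi => hd i (by omega)) (fun i hi => hAd i (by omega))
      have h2 : μ ^ (l - 1) * G + A * |iteratedDeriv l f x| ≤ 2 * (μ ^ (l - 1) * G) := by
        have h3 := hAd l (by omega)
        have h4 := mul_le_mul_of_nonneg_right (one_le_pow₀ hμ : 1 ≤ μ ^ (l - 1)) hG
        linarith
      have h3 : μ ^ (l - 1) * μ ≤ μ ^ k := by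
        rw [← pow_succ]
        exact pow_le_pow_right₀ hμ (by omega)
      calc _ ≤ (C * (2 * (μ ^ (l - 1) * G))) * (μ * |f x|) := by
            gcongr
            · exact h1.trans (mul_le_mul_of_nonneg_left h2 hC)
            · exact hd i (by omega)
        _ = 2 * C * ((μ ^ (l - 1) * μ) * G) * |f x| := by ring
        _ ≤ _ := by gcongr
    have hφ' : ContDiff ℝ (⊤ : ℕ∞) (deriv φ) := hφ.iterate_deriv 1
    have hf' : ContDiff ℝ (⊤ : ℕ∞) (deriv f) := hf.iterate_deriv 1
    have e : iteratedDeriv k (fun x => f x * deriv φ x) x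
        = iteratedDeriv k (fun x => α * (φ x * deriv f x)) x := by rw [funext heq]
    rw [iteratedDeriv_const_mul_field,
      iteratedDeriv_fun_mul (n := k) (hf.of_le (by exact_mod_cast le_top)).contDiffAt
        (hφ'.of_le (by exact_mod_cast le_top)).contDiffAt,
      iteratedDeriv_fun_mul (n := k) (hφ.of_le (by exact_mod_cast le_top)).contDiffAt
        (hf'.of_le (by exact_mod_cast le_top)).contDiffAt,
      Finset.sum_range_succ', Finset.sum_range_succ'] at e
    simp only [← iteratedDeriv_succ', iteratedDeriv_zero, Nat.choose_zero_right, Nat.cast_one,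
      one_mul, Nat.sub_zero] at e
    have b1 : |∑ i ∈ Finset.range k, (k.choose (i + 1) : ℝ) * iteratedDeriv (i + 1) f x *
        iteratedDeriv (k - (i + 1) + 1) φ x| ≤ S * (μ ^ k * G) * |f x| := by
      refine (Finset.abs_sum_le_sum_abs _ _).trans ?_
      rw [hS, Finset.sum_mul, Finset.sum_mul]
      refine Finset.sum_le_sum fun i hi => ?_
      have hi' := Finset.mem_range.1 hi
      have := low (k - (i + 1) + 1) (i + 1) (by omega) (by omega) (by omega)
      rw [abs_mul, abs_mul, Nat.abs_cast]
      have := mul_le_mul_of_nonneg_left this (Nat.cast_nonneg (α := ℝ) (k.choose (i + 1)))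
      linarith
    have b2 : |∑ i ∈ Finset.range k, (k.choose (i + 1) : ℝ) * iteratedDeriv (i + 1) φ x *
        iteratedDeriv (k - (i + 1) + 1) f x| ≤ S * (μ ^ k * G) * |f x| := by
      refine (Finset.abs_sum_le_sum_abs _ _).trans ?_
      rw [hS, Finset.sum_mul, Finset.sum_mul]
      refine Finset.sum_le_sum fun i hi => ?_
      have hi' := Finset.mem_range.1 hi
      have := low (i + 1) (k - (i + 1) + 1) (by omega) (by omega) (by omega)
      rw [abs_mul, abs_mul, Nat.abs_cast]
      have := mul_le_mul_of_nonneg_left this (Nat.cast_nonneg (α := ℝ) (k.choose (i + 1)))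
      linarith
    have b3 : |f x| * |iteratedDeriv (k + 1) φ x| ≤ |α| * (S * (μ ^ k * G) * |f x|
        + A * |f x| * |iteratedDeriv (k + 1) f x|) + S * (μ ^ k * G) * |f x| := by
      rw [← abs_mul, eq_sub_of_add_eq' e]
      refine (abs_sub _ _).trans (add_le_add ?_ b1)
      rw [abs_mul]
      refine mul_le_mul_of_nonneg_left ((abs_add_le _ _).trans (add_le_add b2 ?_)) (abs_nonneg _)
      rw [abs_mul, hA]
    have b4 : |iteratedDeriv (k + 1) φ x| ≤ (|α| * S + S) * (μ ^ k * G)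
        + |α| * (A * |iteratedDeriv (k + 1) f x|) := by
      refine le_of_mul_le_mul_left (b3.trans (le_of_eq ?_)) fpos
      ring
    have p1 : 0 ≤ (C + |α|) * (μ ^ k * G) := by positivity
    have p2 : 0 ≤ (C + (|α| * S + S)) * (A * |iteratedDeriv (k + 1) f x|) := by positivity
    rw [Nat.add_sub_cancel]
    linarith

lemma contDiff_abs_rpow {f : ℝ → ℝ} (hf : ContDiff ℝ (⊤ : ℕ∞) f) (h0 : ∀ x, f x ≠ 0) (α : ℝ) :
    ContDiff ℝ (⊤ : ℕ∞) fun x => |f x| ^ α := by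
  have h : (fun x => |f x| ^ α) = fun x => (f x ^ 2) ^ (α / 2) := by
    ext x
    rw [← sq_abs, ← Real.rpow_natCast_mul (abs_nonneg _)]
    congr 1
    push_cast
    ring
  rw [h]
  exact (hf.pow 2).rpow_const_of_ne fun x => pow_ne_zero 2 (h0 x)

lemma mul_deriv_abs_rpow {f : ℝ → ℝ} (hf : ContDiff ℝ (⊤ : ℕ∞) f) (h0 : ∀ x, f x ≠ 0) (α x : ℝ) :
    f x * deriv (fun x => |f x| ^ α) x = α * (|f x| ^ α * deriv f x) := by
  have h : (fun x => |f x| ^ α) = fun x => (f x ^ 2) ^ (α / 2) := by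
    ext x
    rw [← sq_abs, ← Real.rpow_natCast_mul (abs_nonneg _)]
    congr 1
    push_cast
    ring
  have hd : HasDerivAt f (deriv f x) x :=
    (hf.differentiable (by simp) x).hasDerivAt
  have := ((hd.fun_pow 2).rpow_const (p := α / 2) (Or.inl (pow_ne_zero 2 (h0 x)))).deriv
  rw [congrFun h x, h, this, Real.rpow_sub_one (pow_ne_zero 2 (h0 x))]
  have := h0 x
  field_simp
  norm_num
  ring

lemma exists_abs_iteratedDeriv_nonlin_le (α : ℝ) (hα : α ∈ Set.Ioo (0 : ℝ) 1) (m p γ : ℕ)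
    (hγ : 1 ≤ γ) :
    ∃ C : ℝ, 0 ≤ C ∧ ∀ f : ℝ → ℝ, ContDiff ℝ (⊤ : ℕ∞) f → ∀ lam M : ℝ, 0 < lam →
      (∀ x, lam / 2 ≤ jap x ^ m * |f x|) →
      (∀ i < γ, ∀ x, jap x ^ m * |iteratedDeriv i f x| ≤ M) →
      (∀ x, jap x ^ m * |iteratedDeriv p f x| ≤ M) → ∀ x,
      |jap x ^ m * iteratedDeriv γ (fun y => |f y| ^ α * iteratedDeriv p f y) x|
        ≤ C * ((lam / 2) ^ (α - 1) * M * (2 * M / lam) ^ (γ - 1)) *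
          (∑ k ∈ Finset.range (γ + 1),
              jap x ^ ((m : ℝ) * (1 - α)) * |iteratedDeriv (p + γ - k) f x|
            + jap x ^ m * |iteratedDeriv γ f x|) := by
  obtain ⟨C, hC, hφ⟩ := exists_abs_iteratedDeriv_le α γ
  refine ⟨∑ k ∈ Finset.range (γ + 1), (γ.choose k : ℝ) * (2 * C),
    Finset.sum_nonneg fun i _ => by positivity, fun f hf lam M hlam hlow hM hp x => ?_⟩
  have hJ : ∀ x, 0 < jap x ^ m := fun x => pow_pos (jap_pos x) m
  have h0 : ∀ x, f x ≠ 0 := by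
    intro x hx
    have := hlow x
    rw [hx, abs_zero, mul_zero] at this
    linarith
  have hMf : jap x ^ m * |f x| ≤ M := by simpa using hM 0 hγ x
  have hMlam : lam / 2 ≤ M := (hlow x).trans hMf
  have hM0 : 0 < M := by linarith
  set μ := 2 * M / lam with hμd
  have hμ : 1 ≤ μ := by rw [hμd, le_div_iff₀ hlam]; linarith
  set A := |f x| ^ (α - 1) with hAd
  have hA0 : 0 ≤ A := by positivity
  have fpos : 0 < |f x| := abs_pos.2 (h0 x)
  set B := (lam / 2) ^ (α - 1) with hB
  have hB0 : 0 ≤ B := by positivity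
  set W := jap x ^ ((m : ℝ) * (1 - α)) with hW
  have hW0 : 0 ≤ W := (Real.rpow_pos_of_pos (jap_pos x) _).le
  have hWJ : W ≤ jap x ^ m := by
    rw [hW, ← Real.rpow_natCast]
    apply Real.rpow_le_rpow_of_exponent_le (one_le_jap x)
    have := mul_nonneg (Nat.cast_nonneg (α := ℝ) m) hα.1.le
    linarith
  have hAB : A ≤ B * W := by
    have h1 : lam / 2 / jap x ^ m ≤ |f x| := by
      rw [div_le_iff₀ (hJ x)]
      linarith [hlow x]
    have h2 := Real.rpow_le_rpow_of_nonpos (div_pos (half_pos hlam) (hJ x)) h1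
      (by linarith [hα.2] : α - 1 ≤ 0)
    refine h2.trans (le_of_eq ?_)
    rw [Real.div_rpow (by positivity) (hJ x).le, div_eq_mul_inv, ← Real.rpow_neg (hJ x).le,
      ← Real.rpow_natCast_mul (jap_pos x).le, neg_sub]
  set G := B * W * M / jap x ^ m with hG
  have hG0 : 0 ≤ G := by have := hJ x; positivity
  have hdM : ∀ i < γ, |iteratedDeriv i f x| ≤ M / jap x ^ m := fun i hi => by
    rw [le_div_iff₀ (hJ x), mul_comm]
    exact hM i hi x
  have hd : ∀ i < γ, |iteratedDeriv i f x| ≤ μ * |f x| := fun i hi => by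
    refine (hdM i hi).trans ?_
    rw [div_le_iff₀ (hJ x)]
    have := mul_le_mul_of_nonneg_left (hlow x) (by positivity : 0 ≤ μ)
    have h' : μ * (lam / 2) = M := by rw [hμd]; field_simp
    linarith
  have hAd' : ∀ i < γ, A * |iteratedDeriv i f x| ≤ G := fun i hi => by
    rw [hG, mul_div_assoc]
    exact mul_le_mul hAB (hdM i hi) (abs_nonneg _) (by positivity)
  have hφs := contDiff_abs_rpow hf h0 α
  have hAf : |(|f x| ^ α)| = A * |f x| := by
    rw [abs_of_nonneg (by positivity), hAd, Real.rpow_sub_one fpos.ne']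
    field_simp
  have hφk := hφ (fun x => |f x| ^ α) f hφs hf (mul_deriv_abs_rpow hf h0 α) x μ G A (h0 x) hμ hG0 hAf
  have hμ1 : ∀ k ≤ γ, μ ^ (k - 1) ≤ μ ^ (γ - 1) := fun k hk => pow_le_pow_right₀ hμ (by omega)
  have hμ2 : 1 ≤ μ ^ (γ - 1) := one_le_pow₀ hμ
  set Q := B * M * μ ^ (γ - 1) with hQ
  have hQ0 : 0 ≤ Q := by positivity
  set R := ∑ k ∈ Finset.range (γ + 1), W * |iteratedDeriv (p + γ - k) f x|
            + jap x ^ m * |iteratedDeriv γ f x| with hR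
  have hterm : ∀ k ≤ γ, jap x ^ m * (|iteratedDeriv k (fun x => |f x| ^ α) x| *
      |iteratedDeriv (p + γ - k) f x|) ≤ 2 * C * (Q * R) := by
    intro k hk
    have hsum : W * |iteratedDeriv (p + γ - k) f x| ≤
        ∑ k ∈ Finset.range (γ + 1), W * |iteratedDeriv (p + γ - k) f x| :=
      Finset.single_le_sum (f := fun k => W * |iteratedDeriv (p + γ - k) f x|)
        (fun i _ => by positivity) (Finset.mem_range.2 (by omega))
    have hJγ : 0 ≤ jap x ^ m * |iteratedDeriv γ f x| := by have := hJ x; positivity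
    have base := hφk k hk (fun i hi => hd i (by omega)) (fun i hi => hAd' i (by omega))
    have main : jap x ^ m * (μ ^ (γ - 1) * G * |iteratedDeriv (p + γ - k) f x|)
        = Q * (W * |iteratedDeriv (p + γ - k) f x|) := by
      rw [hQ, hG]
      have := (hJ x).ne'
      field_simp
    rcases Nat.lt_or_ge k γ with hlt | hge
    · have h1 : μ ^ (k - 1) * G + A * |iteratedDeriv k f x| ≤ 2 * (μ ^ (γ - 1) * G) := by
        have e1 := hAd' k hlt
        have e2 := mul_le_mul_of_nonneg_right (hμ1 k hk) hG0
        have e3 := mul_le_mul_of_nonneg_right hμ2 hG0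
        linarith
      calc _ ≤ jap x ^ m * ((C * (2 * (μ ^ (γ - 1) * G))) * |iteratedDeriv (p + γ - k) f x|) := by
            have := hJ x
            gcongr
            exact base.trans (mul_le_mul_of_nonneg_left h1 hC)
        _ = 2 * C * (Q * (W * |iteratedDeriv (p + γ - k) f x|)) := by rw [← main]; ring
        _ ≤ _ := by gcongr; linarith
    · obtain rfl : k = γ := by omega
      have hp' : p + k - k = p := by omega
      have e1 : jap x ^ m * (A * |iteratedDeriv k f x| * |iteratedDeriv p f x|)
          ≤ Q * (jap x ^ m * |iteratedDeriv k f x|) := by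
        calc _ = A * |iteratedDeriv k f x| * (jap x ^ m * |iteratedDeriv p f x|) := by ring
          _ ≤ B * W * |iteratedDeriv k f x| * M := by
            have := hJ x
            gcongr
            exact hp x
          _ = B * M * 1 * (W * |iteratedDeriv k f x|) := by ring
          _ ≤ _ := by rw [hQ]; gcongr
      calc _ ≤ jap x ^ m * ((C * (μ ^ (k - 1) * G + A * |iteratedDeriv k f x|))
              * |iteratedDeriv (p + k - k) f x|) := by
            have := hJ x
            gcongr
        _ = C * (jap x ^ m * (μ ^ (k - 1) * G * |iteratedDeriv (p + k - k) f x|)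
            + jap x ^ m * (A * |iteratedDeriv k f x| * |iteratedDeriv p f x|)) := by
            rw [hp']; ring
        _ ≤ C * (Q * (W * |iteratedDeriv (p + k - k) f x|)
            + Q * (jap x ^ m * |iteratedDeriv k f x|)) := by
            rw [main]; gcongr
        _ = C * (Q * (W * |iteratedDeriv (p + k - k) f x| + jap x ^ m * |iteratedDeriv k f x|)) := by
            ring
        _ ≤ C * (Q * R) := by gcongr; linarith [hR]
        _ ≤ _ := by
            have : 0 ≤ C * (Q * R) := by
              have : 0 ≤ W * |iteratedDeriv (p + k - k) f x| := by positivity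
              have : 0 ≤ R := by linarith
              positivity
            linarith
  have hg : ContDiff ℝ (⊤ : ℕ∞) (iteratedDeriv p f) := by
    rw [iteratedDeriv_eq_iterate]
    exact hf.iterate_deriv p
  rw [iteratedDeriv_fun_mul (n := γ) (hφs.of_le (by exact_mod_cast le_top)).contDiffAt
        (hg.of_le (by exact_mod_cast le_top)).contDiffAt, Finset.mul_sum]
  refine (Finset.abs_sum_le_sum_abs _ _).trans ?_
  rw [mul_assoc, Finset.sum_mul]
  refine Finset.sum_le_sum fun k hk => ?_
  have hk' : k ≤ γ := by have := Finset.mem_range.1 hk; omega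
  have hadd : iteratedDeriv (γ - k) (iteratedDeriv p f) x = iteratedDeriv (p + γ - k) f x := by
    rw [iteratedDeriv_eq_iterate, iteratedDeriv_eq_iterate, iteratedDeriv_eq_iterate,
      ← Function.iterate_add_apply, (by omega : γ - k + p = p + γ - k)]
  rw [hadd, abs_mul, abs_mul, abs_mul, Nat.abs_cast, abs_of_pos (hJ x)]
  have := mul_le_mul_of_nonneg_left (hterm k hk') (Nat.cast_nonneg (α := ℝ) (γ.choose k))
  linarith

lemma abs_le_of_eLinf_le {g : ℝ → ℝ} (hg : Continuous g) {N : ℝ} (hN : 0 ≤ N)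
    (h : eLinf g ≤ ENNReal.ofReal N) (x : ℝ) : |g x| ≤ N := by
  have hae : ∀ᵐ y ∂(volume : Measure ℝ), |g y| ≤ N := by
    filter_upwards [ae_le_eLpNormEssSup (f := g) (μ := volume)] with y hy
    rw [eLinf, eLpNorm_exponent_top] at h
    have := hy.trans h
    rwa [Real.enorm_eq_ofReal_abs, ENNReal.ofReal_le_ofReal_iff hN] at this
  have hcl : IsClosed {y | |g y| ≤ N} := isClosed_le hg.abs continuous_const
  have hd : Dense {y | |g y| ≤ N} := Measure.dense_of_ae hae
  have hx : x ∈ closure {y | |g y| ≤ N} := hd x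
  rwa [hcl.closure_eq] at hx

lemma jap_pow_mul_abs_le {f : ℝ → ℝ} (hf : ContDiff ℝ (⊤ : ℕ∞) f) (m i : ℕ) {N : ℝ} (hN : 0 ≤ N)
    (h₀ : eL2 (fun x => jap x ^ m * iteratedDeriv i f x) ≤ ENNReal.ofReal N)
    (h₁ : eL2 (fun x => jap x ^ m * iteratedDeriv (i + 1) f x) ≤ ENNReal.ofReal N) (x : ℝ) :
    jap x ^ m * |iteratedDeriv i f x| ≤ (2 * m + 2) * N := by
  have cont := hf.continuous_iteratedDeriv_of_top
  have c0 := cont i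
  have c1 := cont (i + 1)
  obtain ⟨i0, b0⟩ := integrable_sq_of_eL2_le (by fun_prop) hN h₀
  obtain ⟨i1, b1⟩ := integrable_sq_of_eL2_le (by fun_prop) hN h₁
  have hd : ∀ x, HasDerivAt (fun x => jap x ^ m * iteratedDeriv i f x)
      (m * jap x ^ (m - 1) * (x / jap x) * iteratedDeriv i f x
        + jap x ^ m * iteratedDeriv (i + 1) f x) x := fun x =>
    ((hasDerivAt_jap x).fun_pow m).mul (hf.hasDerivAt_iteratedDeriv i x)
  have hc : Continuous fun x => m * jap x ^ (m - 1) * (x / jap x) * iteratedDeriv i f x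
        + jap x ^ m * iteratedDeriv (i + 1) f x := by
    have : Continuous fun x => x / jap x :=
      continuous_id.div continuous_jap fun x => (jap_pos x).ne'
    fun_prop
  have pt : ∀ x, (m * jap x ^ (m - 1) * (x / jap x) * iteratedDeriv i f x
        + jap x ^ m * iteratedDeriv (i + 1) f x) ^ 2
      ≤ 2 * m ^ 2 * (jap x ^ m * iteratedDeriv i f x) ^ 2
        + 2 * (jap x ^ m * iteratedDeriv (i + 1) f x) ^ 2 := by
    intro x
    have e1 : (m * jap x ^ (m - 1) * (x / jap x) * iteratedDeriv i f x) ^ 2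
        ≤ m ^ 2 * (jap x ^ m * iteratedDeriv i f x) ^ 2 := by
      have r1 : |x / jap x| ≤ 1 := by
        rw [abs_div, abs_of_pos (jap_pos x), div_le_one (jap_pos x)]
        exact abs_le_jap x
      have r2 : (x / jap x) ^ 2 ≤ 1 := by
        rw [← sq_abs]
        exact pow_le_one₀ (abs_nonneg _) r1
      have r3 : jap x ^ (m - 1) ≤ jap x ^ m :=
        pow_le_pow_right₀ (one_le_jap x) (Nat.sub_le m 1)
      have := (jap_pos x).le
      calc _ = (m : ℝ) ^ 2 * ((jap x ^ (m - 1)) ^ 2 * (x / jap x) ^ 2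
            * iteratedDeriv i f x ^ 2) := by ring
        _ ≤ (m : ℝ) ^ 2 * ((jap x ^ m) ^ 2 * 1 * iteratedDeriv i f x ^ 2) := by gcongr
        _ = _ := by ring
    nlinarith [sq_nonneg (m * jap x ^ (m - 1) * (x / jap x) * iteratedDeriv i f x
      - jap x ^ m * iteratedDeriv (i + 1) f x)]
  have ib := (i0.const_mul (2 * (m : ℝ) ^ 2)).add (i1.const_mul 2)
  have id : Integrable fun x => (m * jap x ^ (m - 1) * (x / jap x) * iteratedDeriv i f x
        + jap x ^ m * iteratedDeriv (i + 1) f x) ^ 2 :=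
    ib.mono' (hc.pow 2).aestronglyMeasurable (ae_of_all _ fun x => by
      rw [Real.norm_eq_abs, abs_of_nonneg (sq_nonneg _)]
      exact pt x)
  have hs := sq_le_integral_add_integral hd hc i0 id x
  have hb := integral_mono id ib pt
  rw [integral_add' (i0.const_mul _) (i1.const_mul _), integral_const_mul,
    integral_const_mul] at hb
  have hm : (0 : ℝ) ≤ m := Nat.cast_nonneg m
  have hJ : 0 ≤ jap x ^ m := (pow_pos (jap_pos x) m).le
  rw [← abs_of_nonneg hJ, ← abs_mul]
  refine abs_le_of_sq_le_sq ?_ (by positivity)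
  have h3 := mul_le_mul_of_nonneg_left b0 (by positivity : 0 ≤ 2 * (m : ℝ) ^ 2)
  nlinarith [mul_nonneg hm (sq_nonneg N), mul_nonneg (sq_nonneg (m : ℝ)) (sq_nonneg N)]

/-- The estimate at a fixed time. -/
lemma exists_eL2_nonlin_le (α : ℝ) (hα : α ∈ Set.Ioo (0 : ℝ) 1) (m s j : ℕ) (hj : 1 ≤ j)
    (hs : (s : ℝ) - 1 ≥ (2 / α) * j + 3 * j) (γ : ℕ) (hγ : 1 ≤ γ) (hγ' : γ ≤ 2 * j + 2) :
    ∃ C : ℝ, 0 ≤ C ∧ ∀ f : ℝ → ℝ, ContDiff ℝ (⊤ : ℕ∞) f → ∀ lam N : ℝ, 0 < lam → 0 ≤ N →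
      (∀ x, lam / 2 ≤ jap x ^ m * |f x|) →
      (∀ k ≤ s, eL2 (iteratedDeriv k f) ≤ ENNReal.ofReal N) →
      eLinf (fun x => jap x ^ m * f x) ≤ ENNReal.ofReal N →
      (∀ i, 1 ≤ i → i ≤ 2 * j + 2 →
        eL2 (fun x => jap x ^ m * iteratedDeriv i f x) ≤ ENNReal.ofReal N) →
      eL2 (fun x => jap x ^ m *
          iteratedDeriv γ (fun y => |f y| ^ α * iteratedDeriv (2 * j - 1) f y) x)
        ≤ ENNReal.ofReal (C * lam ^ (α - γ) * N ^ (γ + 1)) := by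
  have hα0 := hα.1
  have hjR : (1 : ℝ) ≤ j := by exact_mod_cast hj
  have hαs : 2 * (j : ℝ) + α ≤ α * (s - (2 * j + 2)) + α * 1 := by
    have h1 := mul_le_mul_of_nonneg_left hs hα0.le
    have h2 : α * (2 / α * j + 3 * j) = 2 * j + 3 * (α * j) := by field_simp
    have h3 := mul_le_mul_of_nonneg_left hjR hα0.le
    nlinarith
  have hsL : 2 * j + 2 < s := by
    have : (0 : ℝ) < α * (s - (2 * j + 2)) := by linarith
    have := pos_of_mul_pos_right this hα0.le
    exact_mod_cast (by linarith : (2 * (j : ℝ) + 2) < s)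
  obtain ⟨L, hL⟩ : ∃ L, s = 2 * j + 2 + L := ⟨s - (2 * j + 2), by omega⟩
  have hL0 : 0 < L := by omega
  obtain ⟨K, hK, hint⟩ := exists_weighted_interpolation m (2 * j + 2) L hL0
  obtain ⟨D, hD, hpt⟩ := exists_abs_iteratedDeriv_nonlin_le α hα m (2 * j - 1) γ hγ
  set κ : ℝ := 2 * m + 2 with hκ
  have hκ0 : 0 < κ := by positivity
  set S : ℝ := (γ + 1) * (1 + K) + 1 with hS
  have hS0 : 0 < S := by positivity
  refine ⟨D * ((1 / 2) ^ (α - 1) * κ * (2 * κ) ^ (γ - 1)) * S, by positivity,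
    fun f hf lam N hlam hN hlow hH hinf hW => ?_⟩
  have cont := hf.continuous_iteratedDeriv_of_top
  have hM : ∀ i ≤ 2 * j + 1, ∀ x, jap x ^ m * |iteratedDeriv i f x| ≤ κ * N := by
    intro i hi x
    rcases Nat.eq_zero_or_pos i with rfl | hpos
    · have := abs_le_of_eLinf_le (by have := hf.continuous; fun_prop) hN hinf x
      rw [abs_mul, abs_of_nonneg (pow_pos (jap_pos x) m).le] at this
      rw [iteratedDeriv_zero]
      have hm : (0 : ℝ) ≤ m * N := by positivity
      rw [hκ]
      linarith
    · exact jap_pow_mul_abs_le hf m i hN (hW i hpos (by omega)) (hW (i + 1) (by omega) (by omega)) x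
  have hWn : ∀ n, 1 ≤ n → n ≤ 4 * j + 1 →
      eL2 (fun x => jap x ^ ((m : ℝ) * (1 - α)) * |iteratedDeriv n f x|)
        ≤ ENNReal.ofReal ((1 + K) * N) := by
    intro n hn1 hn2
    have mono : ∀ w : ℝ, (m : ℝ) * (1 - α) ≤ w →
        eL2 (fun x => jap x ^ ((m : ℝ) * (1 - α)) * |iteratedDeriv n f x|)
          ≤ eL2 (fun x => jap x ^ w * iteratedDeriv n f x) := by
      intro w hw
      refine eLpNorm_mono fun x => ?_
      rw [norm_mul, norm_mul, norm_abs_eq_norm]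
      refine mul_le_mul_of_nonneg_right ?_ (norm_nonneg _)
      rw [Real.norm_of_nonneg (Real.rpow_nonneg (jap_pos x).le _),
        Real.norm_of_nonneg (Real.rpow_nonneg (jap_pos x).le _)]
      exact Real.rpow_le_rpow_of_exponent_le (one_le_jap x) hw
    rcases Nat.le_total n (2 * j + 2) with hle | hge
    · have h1 := mono m (by nlinarith [mul_nonneg (Nat.cast_nonneg (α := ℝ) m) hα0.le])
      simp only [Real.rpow_natCast] at h1
      refine (h1.trans (hW n hn1 hle)).trans (ENNReal.ofReal_le_ofReal ?_)
      nlinarith [mul_nonneg hK hN]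
    · obtain ⟨r, rfl⟩ := Nat.exists_eq_add_of_le hge
      have hLs : (s : ℝ) = 2 * j + 2 + L := by exact_mod_cast hL
      have hr : (r : ℝ) + 1 ≤ 2 * j := by exact_mod_cast (by omega : r + 1 ≤ 2 * j)
      have hL0' : (0 : ℝ) < L := by exact_mod_cast hL0
      have h1 := mono ((m : ℝ) * ((L : ℝ) - r) / L) (by
        rw [mul_div_assoc]
        refine mul_le_mul_of_nonneg_left ?_ (Nat.cast_nonneg m)
        rw [le_div_iff₀ hL0']
        rw [hLs] at hαs
        linarith)
      have hrL : r ≤ L := by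
        have : (r : ℝ) ≤ L := by
          rw [hLs] at hαs
          have := mul_le_mul_of_nonneg_right hα.2.le hL0'.le
          linarith
        exact_mod_cast this
      refine (h1.trans (hint f hf N hN (fun k hk => hH _ (by omega))
        (hW _ (by omega) le_rfl) r hrL)).trans (ENNReal.ofReal_le_ofReal ?_)
      linarith
  have hpt' := hpt f hf lam (κ * N) hlam hlow (fun i hi => hM i (by omega)) (hM _ (by omega))
  set Q := D * ((lam / 2) ^ (α - 1) * (κ * N) * (2 * (κ * N) / lam) ^ (γ - 1)) with hQ
  have hQ0 : 0 ≤ Q := by positivity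
  have hcJ : Continuous fun x => jap x ^ ((m : ℝ) * (1 - α)) :=
    continuous_jap.rpow_const fun x => Or.inl (jap_pos x).ne'
  have hsum : eL2 (fun x => ∑ k ∈ Finset.range (γ + 1),
      jap x ^ ((m : ℝ) * (1 - α)) * |iteratedDeriv (2 * j - 1 + γ - k) f x|
        + jap x ^ m * |iteratedDeriv γ f x|) ≤ ENNReal.ofReal (S * N) := by
    have m1 : ∀ k, AEStronglyMeasurable (fun x => jap x ^ ((m : ℝ) * (1 - α)) *
        |iteratedDeriv (2 * j - 1 + γ - k) f x|) volume := fun k =>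
      (hcJ.mul (cont _).abs).aestronglyMeasurable
    have e2 : eL2 (fun x => jap x ^ m * |iteratedDeriv γ f x|) ≤ ENNReal.ofReal N := by
      refine le_trans (eLpNorm_mono fun x => ?_) (hW γ hγ hγ')
      rw [norm_mul, norm_mul, norm_abs_eq_norm]
    have e1 : eL2 (∑ k ∈ Finset.range (γ + 1), fun x =>
        jap x ^ ((m : ℝ) * (1 - α)) * |iteratedDeriv (2 * j - 1 + γ - k) f x|)
        ≤ ENNReal.ofReal ((γ + 1) * ((1 + K) * N)) := by
      refine (eLpNorm_sum_le (fun k _ => m1 k) (by norm_num)).trans ?_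
      refine (Finset.sum_le_card_nsmul _ _ _ fun k hk => hWn _ ?_ ?_).trans (le_of_eq ?_)
      · have := Finset.mem_range.1 hk; omega
      · have := Finset.mem_range.1 hk; omega
      · rw [Finset.card_range, nsmul_eq_mul, ← Nat.cast_succ,
          ENNReal.ofReal_mul (p := ((γ.succ : ℕ) : ℝ)) (Nat.cast_nonneg _),
          ENNReal.ofReal_natCast]
    have := eLpNorm_add_le (μ := volume) (p := 2)
      (f := ∑ k ∈ Finset.range (γ + 1), fun x =>
        jap x ^ ((m : ℝ) * (1 - α)) * |iteratedDeriv (2 * j - 1 + γ - k) f x|)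
      (g := fun x => jap x ^ m * |iteratedDeriv γ f x|)
      (Finset.aestronglyMeasurable_sum _ fun k _ => m1 k)
      (by have := cont γ; fun_prop) (by norm_num)
    have hfun : (fun x => ∑ k ∈ Finset.range (γ + 1),
      jap x ^ ((m : ℝ) * (1 - α)) * |iteratedDeriv (2 * j - 1 + γ - k) f x|
        + jap x ^ m * |iteratedDeriv γ f x|) = (∑ k ∈ Finset.range (γ + 1), fun x =>
        jap x ^ ((m : ℝ) * (1 - α)) * |iteratedDeriv (2 * j - 1 + γ - k) f x|)
        + fun x => jap x ^ m * |iteratedDeriv γ f x| := by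
      ext x
      simp
    rw [hfun]
    refine (this.trans (add_le_add e1 e2)).trans ?_
    rw [← ENNReal.ofReal_add (by positivity) hN]
    exact ENNReal.ofReal_le_ofReal (by rw [hS]; linarith)
  calc _ ≤ eL2 (fun x => Q * (∑ k ∈ Finset.range (γ + 1),
      jap x ^ ((m : ℝ) * (1 - α)) * |iteratedDeriv (2 * j - 1 + γ - k) f x|
        + jap x ^ m * |iteratedDeriv γ f x|)) := eLpNorm_mono_real hpt'
    _ ≤ ENNReal.ofReal Q * ENNReal.ofReal (S * N) := by
        refine (eLpNorm_const_smul_le (c := Q) (μ := volume) (p := 2)).trans ?_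
        rw [Real.enorm_of_nonneg hQ0]
        gcongr
        exact hsum
    _ = _ := by
        rw [← ENNReal.ofReal_mul hQ0]
        congr 1
        have e1 : (lam / 2) ^ (α - 1) = (1 / 2) ^ (α - 1) * lam ^ (α - 1) := by
          rw [← Real.mul_rpow (by norm_num) hlam.le]
          congr 1
          ring
        have e2 : lam ^ (α - 1) = lam ^ (α - γ) * lam ^ (γ - 1) := by
          rw [← Real.rpow_add_natCast hlam.ne']
          congr 1
          push_cast [hγ]
          ring
        rw [hQ, e1, e2]
        generalize ((1 : ℝ) / 2) ^ (α - 1) = c₁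
        generalize lam ^ (α - (γ : ℝ)) = c₂
        have e3 : lam ^ (γ - 1) * (2 * (κ * N) / lam) ^ (γ - 1) =
            (2 * κ) ^ (γ - 1) * N ^ (γ - 1) := by
          rw [← mul_pow, ← mul_pow, mul_div_cancel₀ _ hlam.ne', mul_assoc]
        have e4 : N ^ (γ + 1) = N ^ (γ - 1) * N ^ 2 := by
          rw [← pow_add]
          congr 1
          omega
        rw [e4]
        linear_combination D * c₁ * c₂ * κ * S * N ^ 2 * e3

/-- **Nonlinear estimate (3.3)**: for `1 ≤ γ ≤ 2j+2`,
`‖⟨x⟩^m ∂_x^γ (|u|^α ∂_x^{2j-1} u)‖_{L_T^1 L_x^2}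
  ≤ C T λ^{α-1} ‖u‖_{X_T}^2 + C T λ^{α-γ} ‖u‖_{X_T}^{γ+1}`. -/
theorem nonlinear_estimate_33 (α : ℝ) (hα : α ∈ Set.Ioo (0:ℝ) 1) (m : ℕ)
    (hm : m = ⌊1 / α⌋₊ + 1) (s j : ℕ) (hj : 1 ≤ j) (hjs : j ≤ s)
    (hs : (s : ℝ) - 1 ≥ (2 / α) * j + 3 * j) (γ : ℕ) (hγ : 1 ≤ γ) (hγ' : γ ≤ 2 * j + 2) :
    ∃ C : ℝ, 0 < C ∧ ∀ T : ℝ, 0 < T → ∀ lam : ℝ, 0 < lam → ∀ u : ℝ → ℝ → ℝ,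
      ContDiff ℝ (⊤ : ℕ∞) (Function.uncurry u) →
      (∀ t ∈ Set.Icc (0:ℝ) T, ∀ x : ℝ, lam / 2 ≤ jap x ^ m * |u t x|) →
      eLT1L2 T (fun t x => jap x ^ m * iteratedDeriv γ (nonlin α j u t) x)
        ≤ ENNReal.ofReal (C * T * lam ^ (α - 1)) * XT s j m T u ^ (2 : ℝ)
          + ENNReal.ofReal (C * T * lam ^ (α - (γ : ℝ))) * XT s j m T u ^ ((γ : ℝ) + 1) := by
  obtain ⟨C, hC, h⟩ := exists_eL2_nonlin_le α hα m s j hj hs γ hγ hγ'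
  refine ⟨C + 1, by positivity, fun T hT lam hlam u hu hlow => ?_⟩
  set X := XT s j m T u with hX
  rcases eq_or_ne X ⊤ with htop | hfin
  · have hc : ENNReal.ofReal ((C + 1) * T * lam ^ (α - 1)) ≠ 0 := by
      rw [← pos_iff_ne_zero, ENNReal.ofReal_pos]
      positivity
    rw [htop, ENNReal.top_rpow_of_pos two_pos, ENNReal.mul_top hc, top_add]
    exact le_top
  set N := X.toReal with hNd
  have hN : 0 ≤ N := ENNReal.toReal_nonneg
  have hXN : X = ENNReal.ofReal N := (ENNReal.ofReal_toReal hfin).symm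
  have slice : ∀ t ∈ Set.Icc (0 : ℝ) T,
      eL2 (fun x => jap x ^ m * iteratedDeriv γ (nonlin α j u t) x)
        ≤ ENNReal.ofReal (C * lam ^ (α - γ) * N ^ (γ + 1)) := by
    intro t ht
    have sup : ∀ F : ℝ → ℝ≥0∞, F t ≤ eLTinf T F := fun F =>
      le_iSup (fun t : Set.Icc (0 : ℝ) T => F t) ⟨t, ht⟩
    refine h (u t) (hu.comp (contDiff_prodMk_right t)) lam N hlam hN (hlow t ht) ?_ ?_ ?_
    · intro k hk
      rw [← hXN]
      refine (Finset.single_le_sum (f := fun k => eL2 (iteratedDeriv k (u t)))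
        (fun _ _ => zero_le) (Finset.mem_range.2 (Nat.lt_succ_of_le hk))).trans ?_
      refine (sup fun t => eHs s (u t)).trans ?_
      rw [hX, XT, add_assoc, add_assoc]
      exact le_self_add
    · rw [← hXN]
      refine (sup fun t => eLinf fun x => jap x ^ m * u t x).trans ?_
      rw [hX, XT, add_assoc]
      exact le_add_self.trans le_self_add
    · intro i hi1 hi2
      rw [← hXN]
      refine (sup fun t => eL2 fun x => jap x ^ m * iteratedDeriv i (u t) x).trans ?_
      refine (Finset.single_le_sum (f := fun i => eLTinf T fun t =>
        eL2 fun x => jap x ^ m * iteratedDeriv i (u t) x) (fun _ _ => zero_le)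
        (Finset.mem_Icc.2 ⟨hi1, hi2⟩)).trans ?_
      rw [hX, XT]
      exact le_add_self.trans le_self_add
  refine le_trans ?_ le_add_self
  calc eLT1L2 T (fun t x => jap x ^ m * iteratedDeriv γ (nonlin α j u t) x)
      ≤ ∫⁻ _ in Set.Ioc (0 : ℝ) T, ENNReal.ofReal (C * lam ^ (α - γ) * N ^ (γ + 1)) :=
        setLIntegral_mono' measurableSet_Ioc fun t ht => slice t ⟨ht.1.le, ht.2⟩
    _ = ENNReal.ofReal (C * T * lam ^ (α - γ) * N ^ (γ + 1)) := by
        rw [setLIntegral_const, Real.volume_Ioc, sub_zero, ← ENNReal.ofReal_mul (by positivity)]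
        congr 1
        ring
    _ ≤ ENNReal.ofReal ((C + 1) * T * lam ^ (α - γ) * N ^ (γ + 1)) := by
        apply ENNReal.ofReal_le_ofReal
        gcongr
        linarith
    _ = _ := by
        rw [ENNReal.ofReal_mul (by positivity), ENNReal.ofReal_pow hN, ← hXN,
          ← ENNReal.rpow_natCast]
        push_cast
        rfl
end
end

section
/- Let α ∈ (0,1) and let k be a nonnegative integer. There exists a constant C > 0 (depending only on α and k) such that for all nonzero real numbers u and v, | |u|^{α−2k} u^k − |v|^{α−2k} v^k | ≤ C ( |u|^{α−k−1} + |v|^{α−k−1} ) |u − v|. -/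
/-- Mean value estimate for `x ↦ x ^ β` with `β ≤ 1` on a half-line `[a, ∞)`, `a > 0`. -/
theorem abs_rpow_sub_rpow_le_of_le {β a b : ℝ} (hβ : β ≤ 1) (ha : 0 < a) (hab : a ≤ b) :
    |b ^ β - a ^ β| ≤ |β| * a ^ (β - 1) * |b - a| := by
  have hderiv : ∀ x ∈ Set.Ici a, HasDerivWithinAt (fun y : ℝ => y ^ β) (β * x ^ (β - 1))
      (Set.Ici a) x := fun x hx =>
    (Real.hasDerivAt_rpow_const (Or.inl (ha.trans_le hx).ne')).hasDerivWithinAt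
  have hbound : ∀ x ∈ Set.Ici a, ‖β * x ^ (β - 1)‖ ≤ |β| * a ^ (β - 1) := by
    intro x hx
    rw [Real.norm_eq_abs, abs_mul, abs_of_pos (Real.rpow_pos_of_pos (ha.trans_le hx) _)]
    exact mul_le_mul_of_nonneg_left
      (Real.rpow_le_rpow_of_nonpos ha hx (by linarith)) (abs_nonneg β)
  exact (convex_Ici a).norm_image_sub_le_of_norm_hasDerivWithin_le hderiv hbound
    Set.self_mem_Ici hab

theorem abs_rpow_sub_rpow_le {β a b : ℝ} (hβ : β ≤ 1) (ha : 0 < a) (hb : 0 < b) :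
    |a ^ β - b ^ β| ≤ |β| * (a ^ (β - 1) + b ^ (β - 1)) * |a - b| := by
  have hA := (Real.rpow_pos_of_pos ha (β - 1)).le
  have hB := (Real.rpow_pos_of_pos hb (β - 1)).le
  rcases le_total a b with h | h
  · rw [abs_sub_comm (a ^ β), abs_sub_comm a]
    refine (abs_rpow_sub_rpow_le_of_le hβ ha h).trans ?_
    gcongr
    linarith
  · refine (abs_rpow_sub_rpow_le_of_le hβ hb h).trans ?_
    gcongr
    linarith

theorem abs_rpow_mul_pow_eq (α : ℝ) (k : ℕ) {u : ℝ} (hu : u ≠ 0) :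
    |u| ^ (α - 2 * (k : ℝ)) * u ^ k = |u| ^ (α - (k : ℝ)) * (SignType.sign u : ℝ) ^ k := by
  have hpos := abs_pos.mpr hu
  have hpow : |u| ^ (α - (k : ℝ)) = |u| ^ (α - 2 * (k : ℝ)) * |u| ^ k := by
    rw [← Real.rpow_add_natCast hpos.ne']
    ring_nf
  rw [hpow, mul_assoc, ← mul_pow, abs_mul_sign]

/-- **Elementary inequality** (3.8): for `α ∈ (0,1)` and `k` a nonnegative integer,
`| |u|^{α-2k} u^k - |v|^{α-2k} v^k | ≤ C (|u|^{α-k-1} + |v|^{α-k-1}) |u - v|`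
for all nonzero real `u, v`. -/
theorem abs_rpow_mul_pow_sub_le (α : ℝ) (hα : α ∈ Set.Ioo (0:ℝ) 1) (k : ℕ) :
    ∃ C : ℝ, 0 < C ∧ ∀ u v : ℝ, u ≠ 0 → v ≠ 0 →
      |(|u| ^ (α - 2 * (k : ℝ))) * u ^ k - (|v| ^ (α - 2 * (k : ℝ))) * v ^ k|
        ≤ C * (|u| ^ (α - (k : ℝ) - 1) + |v| ^ (α - (k : ℝ) - 1)) * |u - v| := by
  have hβ : α - (k : ℝ) ≤ 1 := by
    have := k.cast_nonneg (α := ℝ)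
    linarith [hα.2]
  refine ⟨|α - k| + 1, by positivity, fun u v hu hv => ?_⟩
  have hu' := abs_pos.mpr hu
  have hv' := abs_pos.mpr hv
  have hsign : ∀ {w : ℝ}, w ≠ 0 → |(SignType.sign w : ℝ) ^ k| = 1 := by
    intro w hw
    rcases hw.lt_or_gt with h | h <;> simp [h]
  rw [abs_rpow_mul_pow_eq α k hu, abs_rpow_mul_pow_eq α k hv]
  by_cases hs : SignType.sign u = SignType.sign v
  · rw [hs, ← sub_mul, abs_mul, hsign hv, mul_one]
    refine (abs_rpow_sub_rpow_le hβ hu' hv').trans ?_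
    refine mul_le_mul ?_ (abs_abs_sub_abs_le u v) (abs_nonneg _) (by positivity)
    gcongr
    linarith
  · have hsum : |u - v| = |u| + |v| := by
      rcases hu.lt_or_gt with h | h <;> rcases hv.lt_or_gt with h' | h'
      · simp [h, h'] at hs
      · rw [abs_of_neg h, abs_of_pos h', abs_of_neg (by linarith)]
        ring
      · rw [abs_of_pos h, abs_of_neg h', abs_of_pos (by linarith)]
        ring
      · simp [h, h'] at hs
    refine (abs_sub _ _).trans ?_
    rw [abs_mul, abs_mul, hsign hu, hsign hv, mul_one, mul_one, hsum,
      abs_of_pos (Real.rpow_pos_of_pos hu' _), abs_of_pos (Real.rpow_pos_of_pos hv' _)]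
    have hmul : ∀ {x : ℝ}, 0 < x → x ^ (α - (k : ℝ)) = x ^ (α - (k : ℝ) - 1) * x := by
      intro x hx
      rw [Real.rpow_sub_one hx.ne', div_mul_cancel₀ _ hx.ne']
    rw [hmul hu', hmul hv']
    have hA := Real.rpow_pos_of_pos hu' (α - (k : ℝ) - 1)
    have hB := Real.rpow_pos_of_pos hv' (α - (k : ℝ) - 1)
    calc |u| ^ (α - (k : ℝ) - 1) * |u| + |v| ^ (α - (k : ℝ) - 1) * |v|
        ≤ 1 * (|u| ^ (α - (k : ℝ) - 1) + |v| ^ (α - (k : ℝ) - 1)) * (|u| + |v|) := by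
          nlinarith [mul_pos hA hv', mul_pos hB hu']
      _ ≤ _ := by
          gcongr
          linarith [abs_nonneg (α - (k : ℝ))]
end
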